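/- Let δ_n be a positive sequence with δ_n → 0, set Λ_n = 1/δ_n, let T_n = L_n(Λ_n+1)δ_n with L_n a positive integer, and let u_n be a minimizer of ℱ^{T_n}_0 over 𝒜^{T_n,Λ_n,δ_n}. Then lim_{n→∞} ℱ^{T_n}_0(u_n) = 1/24. -/

import Mathlib

open MeasureTheory Filter Set Topology

noncomputable section

/-- A function `u : ℝ → ℝ` is piecewise affine: it is affine in a neighborhood of every
point outside a closed discrete set (the corner set). -/
def PiecewiseAffine (u : ℝ → ℝ) : Prop :=
  ∃ S : Set ℝ, IsClosed S ∧ (∀ x ∈ S, ∃ ε > 0, S ∩ Set.Ioo (x - ε) (x + ε) ⊆ {x}) ∧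
    ∀ x ∉ S, ∃ ε > 0, ∃ m q : ℝ, ∀ y : ℝ, |y - x| < ε → u y = m * y + q

/-- The admissible class `𝒜^{T,Λ,δ}`: continuous, `T`-periodic, piecewise affine functions
with slope in `{1, -Λ}` a.e., such that the region where the slope is `-Λ` is a union of
intervals of length `δ` whose pairwise intersections contain at most one point. -/
structure Admissible (T Λ δ : ℝ) (u : ℝ → ℝ) : Prop where
  cont : Continuous u
  per : Function.Periodic u T
  pwAffine : PiecewiseAffine u
  slopes : ∀ᵐ x : ℝ ∂volume, HasDerivAt u 1 x ∨ HasDerivAt u (-Λ) x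
  negRegion : ∃ a : ℕ → ℝ,
    (∀ k : ℕ, Set.Ioo (a k) (a k + δ) ⊆ {x : ℝ | HasDerivAt u (-Λ) x}) ∧
    ({x : ℝ | HasDerivAt u (-Λ) x} ⊆ ⋃ k : ℕ, Set.Icc (a k) (a k + δ)) ∧
    (Pairwise fun i j : ℕ =>
      (Set.Icc (a i) (a i + δ) ∩ Set.Icc (a j) (a j + δ)).Subsingleton)

/-- The `s`-fractional Gagliardo seminorm energy density
`ℱ^T_s(u) = (1/(2T)) ∫_0^T ∫_ℝ |u(x)-u(y)|²/|x-y|^{1+2s} dy dx`. -/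
def Fs (s T : ℝ) (u : ℝ → ℝ) : ℝ :=
  (1 / (2 * T)) * ∫ x in Set.Ioo (0 : ℝ) T, ∫ y : ℝ, (u x - u y) ^ 2 / |x - y| ^ (1 + 2 * s)

/-- The `s`-fractional Laplacian
`(-Δ)^s u (x) = 2 lim_{r→0⁺} ∫_{ℝ∖(x-r,x+r)} (u(x)-u(y))/|x-y|^{1+2s} dy`. -/
def fracLap (s : ℝ) (u : ℝ → ℝ) (x : ℝ) : ℝ :=
  limUnder (𝓝[>] (0 : ℝ)) fun r : ℝ =>
    2 * ∫ y in {y : ℝ | r ≤ |x - y|}, (u x - u y) / |x - y| ^ (1 + 2 * s)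

/-- The function `ū`: the `(Λ+1)δ`-periodic function equal to `-Λx` on `(-δ,0)` and to
`x` on `[0,Λδ]`. -/
def ubar (Λ δ : ℝ) (x : ℝ) : ℝ :=
  let y := ((Λ + 1) * δ) * Int.fract ((x + δ) / ((Λ + 1) * δ)) - δ
  if y < 0 then -Λ * y else y

/-- The extremal energy for `s = 0`: `ℱ^T_0(u) = (1/(2T)) ∫_0^T |u(x)|² dx`. -/
def F0 (T : ℝ) (u : ℝ → ℝ) : ℝ :=
  (1 / (2 * T)) * ∫ x in Set.Ioo (0 : ℝ) T, (u x) ^ 2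

/-- The extremal energy for `s = 1`: `ℱ^T_1(u) = (1/(2T)) ∫_0^T |u'(x)|² dx`. -/
def F1 (T : ℝ) (u : ℝ → ℝ) : ℝ :=
  (1 / (2 * T)) * ∫ x in Set.Ioo (0 : ℝ) T, (deriv u x) ^ 2

theorem hasDerivAt_of_eventuallyEq_affine {f : ℝ → ℝ} {m q x : ℝ}
    (h : ∀ᶠ y in 𝓝 x, f y = m * y + q) : HasDerivAt f m x := by
  have h1 : HasDerivAt (fun z : ℝ => m * z + q) m x := by
    simpa using ((hasDerivAt_id x).const_mul m).add_const q
  exact h1.congr_of_eventuallyEq h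

theorem PiecewiseAffine.exists_countable_hasDerivAt {u : ℝ → ℝ} (hu : PiecewiseAffine u)
    {p q : ℝ} (hslopes : ∀ᵐ x : ℝ ∂volume, HasDerivAt u p x ∨ HasDerivAt u q x) :
    ∃ S : Set ℝ, S.Countable ∧ ∀ x ∉ S, HasDerivAt u p x ∨ HasDerivAt u q x := by
  obtain ⟨S, -, hdisc, haff⟩ := hu
  refine ⟨S, ?_, fun x hx => ?_⟩
  · have : DiscreteTopology S := by
      rw [discreteTopology_subtype_iff]
      intro x hx
      obtain ⟨ε, hε, hS⟩ := hdisc x hx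
      rw [← Filter.empty_mem_iff_bot]
      have h1 : Set.Ioo (x - ε) (x + ε) ∈ 𝓝[≠] x :=
        mem_nhdsWithin_of_mem_nhds (Ioo_mem_nhds (by linarith) (by linarith))
      have h2 : ({x}ᶜ : Set ℝ) ∈ 𝓝[≠] x := self_mem_nhdsWithin
      filter_upwards [mem_inf_of_left h1, mem_inf_of_left h2,
        mem_inf_of_right (mem_principal_self S)] with y hy1 hy2 hy3
      exact hy2 (hS ⟨hy3, hy1⟩)
    exact Set.countable_coe_iff.mp (TopologicalSpace.separableSpace_iff_countable.mp inferInstance)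
  · obtain ⟨ε, hε, m, c, hy⟩ := haff x hx
    have key : ∀ y ∈ Metric.ball x ε, HasDerivAt u m y := by
      intro y hyb
      refine hasDerivAt_of_eventuallyEq_affine (q := c) ?_
      filter_upwards [Metric.isOpen_ball.mem_nhds hyb] with z hz
      exact hy z (by simpa [Real.dist_eq] using hz)
    have hpos : volume (Metric.ball x ε) ≠ 0 := (Metric.measure_ball_pos volume x hε).ne'
    obtain ⟨y, hyb, hys⟩ : ∃ y ∈ Metric.ball x ε, HasDerivAt u p y ∨ HasDerivAt u q y := by
      by_contra! hcon
      refine hpos (measure_mono_null (fun y hyb => ?_) (ae_iff.mp hslopes))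
      rintro hys
      rcases hys with h | h
      · exact (hcon y hyb).1 h
      · exact (hcon y hyb).2 h
    have hxb := key x (Metric.mem_ball_self hε)
    rcases hys with h | h
    · left; rwa [← (key y hyb).unique h]
    · right; rwa [← (key y hyb).unique h]

theorem exists_hasDerivAt_one {T Λ δ : ℝ} {u : ℝ → ℝ} (hu : Admissible T Λ δ u)
    (hT : 0 < T) (hΛ : 0 < Λ) : ∃ x, HasDerivAt u 1 x := by
  by_contra! hcon
  obtain ⟨S, hS, hd⟩ := hu.pwAffine.exists_countable_hasDerivAt hu.slopes
  have h := integral_eq_of_hasDerivAt_off_countable_of_le u (fun _ => -Λ) hT.le hS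
    hu.cont.continuousOn (fun x hx => (hd x hx.2).resolve_left (hcon x))
    intervalIntegrable_const
  have hper := hu.per 0
  rw [zero_add] at hper
  rw [hper, sub_self, intervalIntegral.integral_const, smul_eq_mul] at h
  nlinarith [mul_pos hT hΛ]

section Periodic

variable {ψ : ℝ → ℝ}

theorem integral_zero_add_one_of_periodic (hψ : Continuous ψ) (hper : Function.Periodic ψ 1)
    (hmean : ∫ y in (0 : ℝ)..1, ψ y = 0) (y : ℝ) :
    ∫ t in (0 : ℝ)..(y + 1), ψ t = ∫ t in (0 : ℝ)..y, ψ t := by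
  have h := hper.intervalIntegral_add_eq y 0
  rw [zero_add, hmean] at h
  rw [← intervalIntegral.integral_add_adjacent_intervals (hψ.intervalIntegrable 0 y)
    (hψ.intervalIntegrable y (y + 1)), h, add_zero]

theorem integral_comp_eq_zero_of_slope (hψ : Continuous ψ) (hper : Function.Periodic ψ 1)
    (hmean : ∫ y in (0 : ℝ)..1, ψ y = 0) {Λ δ a : ℝ} {u : ℝ → ℝ} (hu : Continuous u)
    (hΛ : 0 < Λ) (hδ : 0 < δ) (hΛδ : Λ * δ = 1)
    (hd : ∀ x ∈ Set.Ioo a (a + δ), HasDerivAt u (-Λ) x) :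
    ∫ x in Set.Ioo a (a + δ), ψ (u x) = 0 := by
  have hle : a ≤ a + δ := by linarith
  have h1 := intervalIntegral.integral_eq_sub_of_hasDerivAt_of_le hle hu.continuousOn hd
    intervalIntegrable_const
  rw [intervalIntegral.integral_const, smul_eq_mul] at h1
  have hua : u a = u (a + δ) + 1 := by linarith
  have hΦ : ∀ y, HasDerivAt (fun y => ∫ t in (0 : ℝ)..y, ψ t) (ψ y) y := fun y =>
    (hψ.integral_hasStrictDerivAt 0 y).hasDerivAt
  have hΦc : Continuous (fun y => ∫ t in (0 : ℝ)..y, ψ t) :=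
    continuous_iff_continuousAt.mpr fun y => (hΦ y).continuousAt
  have h2 := intervalIntegral.integral_eq_sub_of_hasDerivAt_of_le
    (f := (fun y => ∫ t in (0 : ℝ)..y, ψ t) ∘ u) (f' := fun x => ψ (u x) * -Λ) hle
    (hΦc.comp hu).continuousOn (fun x hx => (hΦ (u x)).comp x (hd x hx))
    (((hψ.comp hu).mul continuous_const).intervalIntegrable _ _)
  simp only [Function.comp_apply] at h2
  rw [hua, integral_zero_add_one_of_periodic hψ hper hmean, sub_self,
    intervalIntegral.integral_mul_const, mul_eq_zero] at h2
  rw [← integral_Ioc_eq_integral_Ioo, ← intervalIntegral.integral_of_le hle]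
  exact h2.resolve_right (by linarith)

/-- Along an admissible function whose negative slopes drop by exactly one on each interval,
the composition with a mean-zero `1`-periodic function has mean zero. -/
theorem Admissible.integral_comp_eq_zero (hψ : Continuous ψ) (hper : Function.Periodic ψ 1)
    (hmean : ∫ y in (0 : ℝ)..1, ψ y = 0) {T Λ δ : ℝ} {u : ℝ → ℝ} (hu : Admissible T Λ δ u)
    (hT : 0 < T) (hΛ : 0 < Λ) (hδ : 0 < δ) (hΛδ : Λ * δ = 1) :
    ∫ x in (0 : ℝ)..T, ψ (u x) = 0 := by
  obtain ⟨x₀, hx₀⟩ := exists_hasDerivAt_one hu hT hΛ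
  have hx₁ : HasDerivAt u 1 (x₀ + T) := by
    have h1 : HasDerivAt (fun y => u (y - T)) 1 (x₀ + T) := by
      have hx : HasDerivAt u 1 (x₀ + T - T) := by simpa using hx₀
      exact hx.comp_sub_const (x₀ + T) T
    have h2 : (fun y => u (y - T)) = u := funext fun y => hu.per.sub_eq y
    rwa [h2] at h1
  have hne : (1 : ℝ) ≠ -Λ := by linarith
  obtain ⟨S, hS, hd⟩ := hu.pwAffine.exists_countable_hasDerivAt hu.slopes
  obtain ⟨a, ha1, ha2, ha3⟩ := hu.negRegion
  have hψu : Continuous fun x => ψ (u x) := hψ.comp hu.cont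
  have hle : x₀ ≤ x₀ + T := by linarith
  have hshift : ∫ x in (0 : ℝ)..T, ψ (u x) = ∫ x in x₀..(x₀ + T), ψ (u x) := by
    have hp : Function.Periodic (fun x => ψ (u x)) T := fun x => by simp only [hu.per x]
    simpa using hp.intervalIntegral_add_eq 0 x₀
  set N : Set ℝ := ⋃ k, Set.Ioo (a k) (a k + δ) with hN
  have hNm : MeasurableSet N := MeasurableSet.iUnion fun k => measurableSet_Ioo
  have hdisj : Pairwise (Function.onFun Disjoint fun k => Set.Ioo (a k) (a k + δ)) := by
    intro i j hij
    rw [Function.onFun, Set.disjoint_left]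
    intro x hxi hxj
    obtain ⟨y, hy1, hy2⟩ : (Set.Ioo x (min (a i + δ) (a j + δ))).Nonempty :=
      Set.nonempty_Ioo.mpr (lt_min hxi.2 hxj.2)
    have hy3 := lt_of_lt_of_le hy2 (min_le_left _ _)
    have hy4 := lt_of_lt_of_le hy2 (min_le_right _ _)
    have := ha3 hij ⟨⟨hxi.1.le, hxi.2.le⟩, ⟨hxj.1.le, hxj.2.le⟩⟩
      ⟨⟨(hxi.1.trans hy1).le, hy3.le⟩, ⟨(hxj.1.trans hy1).le, hy4.le⟩⟩
    linarith
  have hnot : ∀ x, HasDerivAt u 1 x → ∀ k, x ∉ Set.Ioo (a k) (a k + δ) :=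
    fun x hx k hk => hne (hx.unique (ha1 k hk))
  have hNint : ∫ x in Set.Ioc x₀ (x₀ + T) ∩ N, ψ (u x) = 0 := by
    rw [hN, Set.inter_iUnion, integral_iUnion
      (fun k => measurableSet_Ioc.inter measurableSet_Ioo)
      (fun i j hij => (hdisj hij).mono inf_le_right inf_le_right)
      ((hψu.integrableOn_Icc (a := x₀) (b := x₀ + T)).mono_set
        (Set.iUnion_subset fun k => Set.inter_subset_left.trans Set.Ioc_subset_Icc_self))]
    refine (tsum_congr fun k => ?_).trans tsum_zero
    have h0 := hnot _ hx₀ k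
    have h1 := hnot _ hx₁ k
    by_cases hk : (Set.Ioc x₀ (x₀ + T) ∩ Set.Ioo (a k) (a k + δ)).Nonempty
    · have : Set.Ioc x₀ (x₀ + T) ∩ Set.Ioo (a k) (a k + δ) = Set.Ioo (a k) (a k + δ) := by
        obtain ⟨z, ⟨hz1, hz2⟩, hz3, hz4⟩ := hk
        refine Set.inter_eq_right.mpr fun y hy => ⟨?_, ?_⟩
        · by_contra! hcon
          exact h0 ⟨by linarith [hy.1], by linarith⟩
        · by_contra! hcon
          rcases hz2.eq_or_lt with h | h
          · exact h1 ⟨by linarith, by linarith⟩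
          · exact h1 ⟨by linarith, by linarith [hy.2]⟩
      rw [this]
      exact integral_comp_eq_zero_of_slope hψ hper hmean hu.cont hΛ hδ hΛδ (ha1 k)
    · rw [Set.not_nonempty_iff_eq_empty.mp hk, Measure.restrict_empty, integral_zero_measure]
  have hΦ : ∀ y, HasDerivAt (fun y => ∫ t in (0 : ℝ)..y, ψ t) (ψ y) y := fun y =>
    (hψ.integral_hasStrictDerivAt 0 y).hasDerivAt
  have hΦc : Continuous (fun y => ∫ t in (0 : ℝ)..y, ψ t) :=
    continuous_iff_continuousAt.mpr fun y => (hΦ y).continuousAt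
  have hint1 : IntegrableOn (fun x => ψ (u x)) (Set.Ioc x₀ (x₀ + T)) volume :=
    (hψu.integrableOn_Icc (a := x₀) (b := x₀ + T)).mono_set Set.Ioc_subset_Icc_self
  have hint2 : IntegrableOn (N.indicator fun x => (1 + Λ) * ψ (u x))
      (Set.Ioc x₀ (x₀ + T)) volume := (hint1.const_mul (1 + Λ)).indicator hNm
  have hftc := integral_eq_of_hasDerivAt_off_countable_of_le
    ((fun y => ∫ t in (0 : ℝ)..y, ψ t) ∘ u)
    (fun x => ψ (u x) - N.indicator (fun x => (1 + Λ) * ψ (u x)) x) hle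
    ((hS.union (Set.countable_range a)).union (Set.countable_range fun k => a k + δ))
    (hΦc.comp hu.cont).continuousOn
    (by
      rintro x ⟨-, hx⟩
      simp only [Set.mem_union, Set.mem_range, not_or, not_exists] at hx
      obtain ⟨⟨hxS, hxa⟩, hxb⟩ := hx
      rcases hd x hxS with h | h
      · have hxN : x ∉ N := by
          simp only [hN, Set.mem_iUnion, not_exists]
          exact hnot x h
        rw [Set.indicator_of_notMem hxN, sub_zero]
        simpa using (hΦ (u x)).comp x h
      · have hxN : x ∈ N := by
          obtain ⟨k, hk⟩ := Set.mem_iUnion.mp (ha2 h)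
          exact Set.mem_iUnion.mpr ⟨k, lt_of_le_of_ne hk.1 (hxa k),
            lt_of_le_of_ne hk.2 (Ne.symm (hxb k))⟩
        rw [Set.indicator_of_mem hxN]
        have hc := (hΦ (u x)).comp x h
        rwa [show ψ (u x) * -Λ = ψ (u x) - (1 + Λ) * ψ (u x) by ring] at hc)
    ((intervalIntegrable_iff_integrableOn_Ioc_of_le hle).mpr (hint1.sub hint2))
  simp only [Function.comp_apply] at hftc
  rw [hu.per x₀, sub_self, intervalIntegral.integral_of_le hle,
    integral_sub hint1 hint2, setIntegral_indicator hNm, integral_const_mul, hNint, mul_zero,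
    sub_zero] at hftc
  rw [hshift, intervalIntegral.integral_of_le hle, hftc]

end Periodic

/-- The squared distance to the nearest integer. -/
def sqDistInt (y : ℝ) : ℝ := ‖(y : UnitAddCircle)‖ ^ 2

theorem continuous_sqDistInt : Continuous sqDistInt :=
  ((AddCircle.continuous_mk' (1 : ℝ)).norm).pow 2

theorem periodic_sqDistInt : Function.Periodic sqDistInt 1 := fun y => by
  simp [sqDistInt]

theorem sqDistInt_le_sq (y : ℝ) : sqDistInt y ≤ y ^ 2 := by
  rw [sqDistInt, UnitAddCircle.norm_eq, sq_abs, sq_le_sq]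
  simpa using round_le y 0

theorem sqDistInt_eq_sq {y : ℝ} (hy : |y| ≤ 1 / 2) : sqDistInt y = y ^ 2 := by
  rw [sqDistInt, (AddCircle.norm_coe_eq_abs_iff (1 : ℝ) one_ne_zero).mpr (by simpa using hy),
    sq_abs]

theorem integral_sqDistInt : ∫ y in (0 : ℝ)..1, sqDistInt y = 1 / 12 := by
  have h := periodic_sqDistInt.intervalIntegral_add_eq 0 (-1 / 2)
  rw [zero_add] at h
  rw [h, intervalIntegral.integral_congr (g := fun y => y ^ 2)]
  · rw [integral_pow]
    norm_num
  · intro y hy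
    rw [Set.uIcc_of_le (by norm_num)] at hy
    exact sqDistInt_eq_sq (abs_le.mpr ⟨by linarith [hy.1], by linarith [hy.2]⟩)

section Energy

variable {T Λ δ : ℝ} {u : ℝ → ℝ}

theorem F0_eq_intervalIntegral (hT : 0 < T) :
    F0 T u = (1 / (2 * T)) * ∫ x in (0 : ℝ)..T, (u x) ^ 2 := by
  rw [F0, intervalIntegral.integral_of_le hT.le, integral_Ioc_eq_integral_Ioo]

theorem Admissible.integral_sqDistInt_comp (hu : Admissible T Λ δ u)
    (hT : 0 < T) (hΛ : 0 < Λ) (hδ : 0 < δ) (hΛδ : Λ * δ = 1) :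
    ∫ x in (0 : ℝ)..T, sqDistInt (u x) = T / 12 := by
  have h := hu.integral_comp_eq_zero (ψ := fun y => sqDistInt y - 1 / 12)
    (continuous_sqDistInt.sub continuous_const)
    (fun y => by simp only [periodic_sqDistInt y])
    (by
      rw [intervalIntegral.integral_sub (continuous_sqDistInt.intervalIntegrable _ _)
        intervalIntegrable_const, integral_sqDistInt]
      simp)
    hT hΛ hδ hΛδ
  have hc : Continuous fun x => sqDistInt (u x) := continuous_sqDistInt.comp hu.cont
  rw [intervalIntegral.integral_sub (hc.intervalIntegrable _ _) intervalIntegrable_const,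
    intervalIntegral.integral_const, smul_eq_mul] at h
  linarith

theorem Admissible.le_F0 (hu : Admissible T Λ δ u)
    (hT : 0 < T) (hΛ : 0 < Λ) (hδ : 0 < δ) (hΛδ : Λ * δ = 1) : 1 / 24 ≤ F0 T u := by
  have h : T / 12 ≤ ∫ x in (0 : ℝ)..T, (u x) ^ 2 := by
    rw [← hu.integral_sqDistInt_comp hT hΛ hδ hΛδ]
    exact intervalIntegral.integral_mono hT.le
      ((continuous_sqDistInt.comp hu.cont).intervalIntegrable _ _)
      ((hu.cont.pow 2).intervalIntegrable _ _) fun x => sqDistInt_le_sq (u x)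
  rw [F0_eq_intervalIntegral hT]
  calc (1 : ℝ) / 24 = 1 / (2 * T) * (T / 12) := by field_simp; norm_num
    _ ≤ _ := by gcongr

theorem Admissible.F0_eq (hu : Admissible T Λ δ u)
    (hT : 0 < T) (hΛ : 0 < Λ) (hδ : 0 < δ) (hΛδ : Λ * δ = 1) (hb : ∀ x, |u x| ≤ 1 / 2) :
    F0 T u = 1 / 24 := by
  have h : ∫ x in (0 : ℝ)..T, (u x) ^ 2 = T / 12 := by
    rw [← hu.integral_sqDistInt_comp hT hΛ hδ hΛδ]
    exact intervalIntegral.integral_congr fun x _ => (sqDistInt_eq_sq (hb x)).symm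
  rw [F0_eq_intervalIntegral hT, h]
  field_simp
  norm_num

end Energy

/-- The sawtooth of period `(Λ + 1) * δ`, centred to have zero mean when `Λ * δ = 1`. -/
def sawtooth (Λ δ : ℝ) : ℝ → ℝ :=
  (fun t => max ((Λ + 1) * δ * t - δ) (-Λ * ((Λ + 1) * δ * t - δ)) - 1 / 2) ∘ Int.fract ∘
    fun x => (x + δ) / ((Λ + 1) * δ)

section Sawtooth

variable {Λ δ : ℝ}

theorem sawtooth_eq (hΛ : 0 < Λ) (hδ : 0 < δ) (n : ℤ) {x : ℝ}
    (h1 : n * ((Λ + 1) * δ) - δ ≤ x) (h2 : x < n * ((Λ + 1) * δ) + Λ * δ) :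
    sawtooth Λ δ x =
      max (x - n * ((Λ + 1) * δ)) (-Λ * (x - n * ((Λ + 1) * δ))) - 1 / 2 := by
  have hh : 0 < (Λ + 1) * δ := by positivity
  have hfl : ⌊(x + δ) / ((Λ + 1) * δ)⌋ = n := by
    rw [Int.floor_eq_iff, le_div_iff₀ hh, div_lt_iff₀ hh]
    constructor <;> nlinarith
  have hfr : (Λ + 1) * δ * Int.fract ((x + δ) / ((Λ + 1) * δ)) - δ = x - n * ((Λ + 1) * δ) := by
    rw [Int.fract, hfl]
    field_simp
    ring
  simp only [sawtooth, Function.comp_apply, hfr]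

theorem exists_sawtooth_cell (hΛ : 0 < Λ) (hδ : 0 < δ) (x : ℝ) :
    ∃ n : ℤ, n * ((Λ + 1) * δ) - δ ≤ x ∧ x < n * ((Λ + 1) * δ) + Λ * δ := by
  have hh : 0 < (Λ + 1) * δ := by positivity
  refine ⟨⌊(x + δ) / ((Λ + 1) * δ)⌋, ?_, ?_⟩
  · have := Int.floor_le ((x + δ) / ((Λ + 1) * δ))
    rw [le_div_iff₀ hh] at this
    linarith
  · have := Int.lt_floor_add_one ((x + δ) / ((Λ + 1) * δ))
    rw [div_lt_iff₀ hh] at this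
    linarith

theorem sawtooth_eq_of_neg (hΛ : 0 < Λ) (hδ : 0 < δ) (n : ℤ) {x : ℝ}
    (h1 : n * ((Λ + 1) * δ) - δ < x) (h2 : x < n * ((Λ + 1) * δ)) :
    sawtooth Λ δ x = -Λ * x + (Λ * (n * ((Λ + 1) * δ)) - 1 / 2) := by
  rw [sawtooth_eq hΛ hδ n h1.le (by nlinarith [mul_pos hΛ hδ]), max_eq_right (by nlinarith)]
  ring

theorem sawtooth_eq_of_pos (hΛ : 0 < Λ) (hδ : 0 < δ) (n : ℤ) {x : ℝ}
    (h1 : n * ((Λ + 1) * δ) < x) (h2 : x < n * ((Λ + 1) * δ) + Λ * δ) :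
    sawtooth Λ δ x = 1 * x + (-(n * ((Λ + 1) * δ)) - 1 / 2) := by
  rw [sawtooth_eq hΛ hδ n (by linarith) h2, max_eq_left (by nlinarith)]
  ring

theorem abs_sawtooth_le (hΛ : 0 < Λ) (hδ : 0 < δ) (hΛδ : Λ * δ = 1) (x : ℝ) :
    |sawtooth Λ δ x| ≤ 1 / 2 := by
  obtain ⟨n, h1, h2⟩ := exists_sawtooth_cell hΛ hδ x
  rw [sawtooth_eq hΛ hδ n h1 h2, abs_le]
  set y := x - n * ((Λ + 1) * δ)
  have hy1 : -δ ≤ y := by simp only [y]; linarith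
  have hy2 : y < 1 := by simp only [y]; linarith
  have hm : max y (-Λ * y) ≤ 1 := max_le hy2.le (by nlinarith)
  have hm' : 0 ≤ max y (-Λ * y) := by
    rcases le_total 0 y with h | h
    · exact h.trans (le_max_left _ _)
    · exact le_max_of_le_right (by nlinarith)
  constructor <;> linarith

theorem continuous_sawtooth (hΛδ : Λ * δ = 1) (hδ : 0 < δ) : Continuous (sawtooth Λ δ) := by
  rw [sawtooth, ← Function.comp_assoc]
  refine Continuous.comp (ContinuousOn.comp_fract'' ?_ ?_) (by fun_prop)
  · exact (by fun_prop : Continuous fun t : ℝ =>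
      max ((Λ + 1) * δ * t - δ) (-Λ * ((Λ + 1) * δ * t - δ)) - 1 / 2).continuousOn
  · have hΛ : 0 < Λ := by
      by_contra! h
      nlinarith
    have e1 : (Λ + 1) * δ * 0 - δ = -δ := by ring
    have e2 : (Λ + 1) * δ * 1 - δ = 1 := by linarith
    rw [e1, e2, max_eq_right (by nlinarith), max_eq_left (by nlinarith)]
    linarith

theorem periodic_sawtooth (hh : (Λ + 1) * δ ≠ 0) (L : ℕ) :
    Function.Periodic (sawtooth Λ δ) (L * ((Λ + 1) * δ)) := by
  intro x
  have : (x + L * ((Λ + 1) * δ) + δ) / ((Λ + 1) * δ) = (x + δ) / ((Λ + 1) * δ) + L := by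
    rw [add_right_comm, add_div, mul_div_cancel_right₀ _ hh]
  simp only [sawtooth, Function.comp_apply, this, Int.fract_add_natCast]

/-- The corners of the sawtooth. -/
def sawtoothCorners (Λ δ : ℝ) : Set ℝ :=
  (fun x => x / ((Λ + 1) * δ)) ⁻¹' Set.range ((↑) : ℤ → ℝ) ∪
    (fun x => (x + δ) / ((Λ + 1) * δ)) ⁻¹' Set.range ((↑) : ℤ → ℝ)

theorem mem_sawtoothCorners (hh : (Λ + 1) * δ ≠ 0) {x : ℝ} :
    x ∈ sawtoothCorners Λ δ ↔
      ∃ n : ℤ, x = n * ((Λ + 1) * δ) ∨ x = n * ((Λ + 1) * δ) - δ := by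
  simp only [sawtoothCorners, Set.mem_union, Set.mem_preimage, Set.mem_range, exists_or,
    eq_div_iff hh]
  refine or_congr (exists_congr fun n => eq_comm) (exists_congr fun n => ?_)
  constructor <;> intro h <;> linarith

theorem isClosed_sawtoothCorners : IsClosed (sawtoothCorners Λ δ) :=
  (Int.isClosedEmbedding_coe_real.isClosed_range.preimage (by fun_prop)).union
    (Int.isClosedEmbedding_coe_real.isClosed_range.preimage (by fun_prop))

theorem int_eq_of_abs_sub_mul_lt {h : ℝ} (hh : 0 < h) {m n : ℤ}
    (h1 : (n : ℝ) * h - h < m * h) (h2 : (m : ℝ) * h < n * h + h) : m = n := by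
  have h3 : ((n - 1 : ℤ) : ℝ) < m := by
    push_cast
    by_contra! hc
    nlinarith
  have h4 : (m : ℝ) < ((n + 1 : ℤ) : ℝ) := by
    push_cast
    by_contra! hc
    nlinarith
  have h5 : n - 1 < m := by exact_mod_cast h3
  have h6 : m < n + 1 := by exact_mod_cast h4
  omega

theorem sawtoothCorners_discrete (hΛ : 0 < Λ) (hδ : 0 < δ) {x : ℝ}
    (hx : x ∈ sawtoothCorners Λ δ) :
    ∃ ε > 0, sawtoothCorners Λ δ ∩ Set.Ioo (x - ε) (x + ε) ⊆ {x} := by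
  have hh : 0 < (Λ + 1) * δ := by positivity
  have hΛδ := mul_pos hΛ hδ
  have hadd : (Λ + 1) * δ = Λ * δ + δ := by ring
  refine ⟨min δ (Λ * δ), lt_min hδ hΛδ, ?_⟩
  rintro y ⟨hy, hy1, hy2⟩
  have hm1 := min_le_left δ (Λ * δ)
  have hm2 := min_le_right δ (Λ * δ)
  rw [mem_sawtoothCorners hh.ne'] at hx hy
  obtain ⟨n, hn⟩ := hx
  obtain ⟨m, hm⟩ := hy
  have hmn : m = n ∨ m = n + 1 ∨ m = n - 1 := by
    by_contra! hc
    have hgt : m ≤ n - 2 ∨ n + 2 ≤ m := by omega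
    rcases hgt with h | h
    · have h' : (m : ℝ) ≤ n - 2 := by exact_mod_cast h
      rcases hn with rfl | rfl <;> rcases hm with rfl | rfl <;>
        nlinarith [mul_le_mul_of_nonneg_right h' hh.le]
    · have h' : (n : ℝ) + 2 ≤ m := by exact_mod_cast h
      rcases hn with rfl | rfl <;> rcases hm with rfl | rfl <;>
        nlinarith [mul_le_mul_of_nonneg_right h' hh.le]
  rw [Set.mem_singleton_iff]
  rcases hmn with rfl | rfl | rfl <;> push_cast at * <;>
    rcases hn with rfl | rfl <;> rcases hm with rfl | rfl <;> first | rfl | (exfalso; nlinarith)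

theorem exists_sawtooth_slope (hΛ : 0 < Λ) (hδ : 0 < δ) {x : ℝ}
    (hx : x ∉ sawtoothCorners Λ δ) :
    ∃ ε > 0, ∃ m q : ℝ, (m = 1 ∨ m = -Λ) ∧
      ∀ y : ℝ, |y - x| < ε → sawtooth Λ δ y = m * y + q := by
  have hh : 0 < (Λ + 1) * δ := by positivity
  rw [mem_sawtoothCorners hh.ne'] at hx
  push Not at hx
  obtain ⟨n, h1, h2⟩ := exists_sawtooth_cell hΛ hδ x
  obtain ⟨hn1, hn2⟩ := hx n
  rcases hn1.lt_or_gt with h | h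
  · have h1' := lt_of_le_of_ne h1 hn2.symm
    refine ⟨min (x - (n * ((Λ + 1) * δ) - δ)) (n * ((Λ + 1) * δ) - x),
      lt_min (by linarith) (by linarith), -Λ, Λ * (n * ((Λ + 1) * δ)) - 1 / 2, Or.inr rfl, fun y hy => ?_⟩
    obtain ⟨hy1, hy2⟩ := lt_min_iff.mp hy
    rw [abs_lt] at hy1 hy2
    exact sawtooth_eq_of_neg hΛ hδ n (by linarith) (by linarith)
  · refine ⟨min (x - n * ((Λ + 1) * δ)) (n * ((Λ + 1) * δ) + Λ * δ - x),
      lt_min (by linarith) (by linarith), 1, -(n * ((Λ + 1) * δ)) - 1 / 2, Or.inl rfl, fun y hy => ?_⟩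
    obtain ⟨hy1, hy2⟩ := lt_min_iff.mp hy
    rw [abs_lt] at hy1 hy2
    exact sawtooth_eq_of_pos hΛ hδ n (by linarith) (by linarith)

theorem countable_sawtoothCorners (hh : (Λ + 1) * δ ≠ 0) : (sawtoothCorners Λ δ).Countable := by
  refine ((Set.countable_range fun n : ℤ => (n : ℝ) * ((Λ + 1) * δ)).union
    (Set.countable_range fun n : ℤ => (n : ℝ) * ((Λ + 1) * δ) - δ)).mono fun x hx => ?_
  obtain ⟨n, rfl | rfl⟩ := (mem_sawtoothCorners hh).mp hx
  · exact Or.inl ⟨n, rfl⟩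
  · exact Or.inr ⟨n, rfl⟩

theorem admissible_sawtooth (hΛ : 0 < Λ) (hδ : 0 < δ) (hΛδ : Λ * δ = 1) (L : ℕ) :
    Admissible (L * ((Λ + 1) * δ)) Λ δ (sawtooth Λ δ) := by
  have hh : 0 < (Λ + 1) * δ := by positivity
  have hadd : (Λ + 1) * δ = Λ * δ + δ := by ring
  refine ⟨continuous_sawtooth hΛδ hδ, periodic_sawtooth hh.ne' L,
    ⟨sawtoothCorners Λ δ, isClosed_sawtoothCorners,
      fun x hx => sawtoothCorners_discrete hΛ hδ hx, fun x hx => ?_⟩, ?_, ?_⟩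
  · obtain ⟨ε, hε, m, q, -, h⟩ := exists_sawtooth_slope hΛ hδ hx
    exact ⟨ε, hε, m, q, h⟩
  · filter_upwards [(countable_sawtoothCorners hh.ne').ae_notMem volume] with x hx
    obtain ⟨ε, hε, m, q, hm, h⟩ := exists_sawtooth_slope hΛ hδ hx
    have hd : HasDerivAt (sawtooth Λ δ) m x := by
      refine hasDerivAt_of_eventuallyEq_affine (q := q) ?_
      filter_upwards [Metric.ball_mem_nhds x hε] with y hy
      exact h y (by simpa [Real.dist_eq] using hy)
    rcases hm with rfl | rfl
    · exact Or.inl hd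
    · exact Or.inr hd
  · let e : ℤ ≃ ℕ := Denumerable.eqv ℤ
    refine ⟨fun k => (e.symm k : ℝ) * ((Λ + 1) * δ) - δ, fun k x hx => ?_, fun x hx => ?_,
      fun i j hij => ?_⟩
    · refine hasDerivAt_of_eventuallyEq_affine
        (q := Λ * (e.symm k * ((Λ + 1) * δ)) - 1 / 2) ?_
      filter_upwards [isOpen_Ioo.mem_nhds hx] with y hy
      exact sawtooth_eq_of_neg hΛ hδ (e.symm k) hy.1 (by linarith [hy.2])
    · obtain ⟨n, h1, h2⟩ := exists_sawtooth_cell hΛ hδ x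
      refine Set.mem_iUnion.mpr ⟨e n, ?_⟩
      simp only [Equiv.symm_apply_apply]
      refine ⟨h1, ?_⟩
      by_contra! hc
      have hd : HasDerivAt (sawtooth Λ δ) 1 x := by
        refine hasDerivAt_of_eventuallyEq_affine (q := -(n * ((Λ + 1) * δ)) - 1 / 2) ?_
        filter_upwards [Ioo_mem_nhds (show (n : ℝ) * ((Λ + 1) * δ) < x by linarith) h2] with y hy
        exact sawtooth_eq_of_pos hΛ hδ n hy.1 hy.2
      have := hd.unique hx
      linarith
    · rintro x ⟨⟨hx1, hx2⟩, hx3, hx4⟩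
      refine absurd (e.symm.injective ?_) hij
      exact int_eq_of_abs_sub_mul_lt hh (by linarith) (by linarith)

end Sawtooth

/-- asymptotics of the minimal energy for `s = 0`. -/
theorem statement7
    (δ : ℕ → ℝ) (hδpos : ∀ n, 0 < δ n) (hδ0 : Tendsto δ atTop (𝓝 0))
    (L : ℕ → ℕ) (hL : ∀ n, 0 < L n)
    (T : ℕ → ℝ) (hT : ∀ n, T n = (L n : ℝ) * ((1 / δ n + 1) * δ n))
    (u : ℕ → ℝ → ℝ) (hadm : ∀ n, Admissible (T n) (1 / δ n) (δ n) (u n))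
    (hmin : ∀ n, ∀ v : ℝ → ℝ, Admissible (T n) (1 / δ n) (δ n) v →
      F0 (T n) (u n) ≤ F0 (T n) v) :
    Tendsto (fun n => F0 (T n) (u n)) atTop (𝓝 (1 / 24)) := by
  have key : ∀ n, F0 (T n) (u n) = 1 / 24 := by
    intro n
    have hδ := hδpos n
    have hΛ : 0 < 1 / δ n := by positivity
    have hΛδ : 1 / δ n * δ n = 1 := one_div_mul_cancel hδ.ne'
    have hLn : (0 : ℝ) < L n := by exact_mod_cast hL n
    have hTn : 0 < T n := by
      rw [hT n]
      positivity
    have hv : Admissible (T n) (1 / δ n) (δ n) (sawtooth (1 / δ n) (δ n)) := by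
      rw [hT n]
      exact admissible_sawtooth hΛ hδ hΛδ (L n)
    refine le_antisymm ((hmin n _ hv).trans_eq ?_) ((hadm n).le_F0 hTn hΛ hδ hΛδ)
    exact hv.F0_eq hTn hΛ hδ hΛδ (abs_sawtooth_le hΛ hδ hΛδ)
  simp only [key]
  exact tendsto_const_nhds
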